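/- Let m be a propositional (X-free) formula over AP and φ an LTL_X formula in which X is applied only to literals. Let RmModes(φ, m) be the formula obtained from φ by replacing every maximal X-free subformula f of φ such that m → f is propositionally valid by true, and every maximal X-free subformula f such that m → ¬f is propositionally valid by false. Then for every trace σ whose first letter satisfies m (i.e., σ ⊨ m), σ satisfies φ if and only if σ satisfies RmModes(φ, m). -/

import Mathlib

/-- LTL_X formulas over atomic propositions `AP`: the only temporal operator
is the next operator `X` (`next`).  `ff` is the derived constant `false`. -/
inductive LTLX (AP : Type) : Type where
  | tt : LTLX AP
  | ff : LTLX AP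
  | atom : AP → LTLX AP
  | neg : LTLX AP → LTLX AP
  | or : LTLX AP → LTLX AP → LTLX AP
  | and : LTLX AP → LTLX AP → LTLX AP
  | next : LTLX AP → LTLX AP
  deriving DecidableEq

variable {AP : Type}

/-- The suffix `σ^i` of a trace `σ`. -/
def shift (σ : ℕ → Set AP) (i : ℕ) : ℕ → Set AP := fun n => σ (n + i)

/-- Satisfaction of an LTL_X formula on an infinite trace `σ : ℕ → Set AP`. -/
def LTLX.sat (σ : ℕ → Set AP) : LTLX AP → Prop
  | .tt => True
  | .ff => False
  | .atom a => a ∈ σ 0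
  | .neg φ => ¬ LTLX.sat σ φ
  | .or φ ψ => LTLX.sat σ φ ∨ LTLX.sat σ ψ
  | .and φ ψ => LTLX.sat σ φ ∧ LTLX.sat σ ψ
  | .next φ => LTLX.sat (shift σ 1) φ

/-- Implication, a derived Boolean connective. -/
def LTLX.imp (φ ψ : LTLX AP) : LTLX AP := .or (.neg φ) ψ

/-- `φ` contains no occurrence of the next operator `X` (`φ` is propositional). -/
def XFree : LTLX AP → Prop
  | .tt => True
  | .ff => True
  | .atom _ => True
  | .neg φ => XFree φ
  | .or φ ψ => XFree φ ∧ XFree ψ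
  | .and φ ψ => XFree φ ∧ XFree ψ
  | .next _ => False

/-- A literal is an atomic proposition or the negation of an atomic proposition. -/
def IsLiteral : LTLX AP → Prop
  | .atom _ => True
  | .neg (.atom _) => True
  | _ => False

/-- Chains of `X` over a literal: a literal, or `X` applied to such a chain. -/
inductive NextChain : LTLX AP → Prop where
  | lit {ℓ : LTLX AP} : IsLiteral ℓ → NextChain ℓ
  | next {φ : LTLX AP} : NextChain φ → NextChain (.next φ)

/-- `X` is applied only to literals. -/
inductive XOnlyLit : LTLX AP → Prop where
  | tt : XOnlyLit .tt
  | ff : XOnlyLit .ff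
  | atom (a : AP) : XOnlyLit (.atom a)
  | neg {φ : LTLX AP} : XOnlyLit φ → XOnlyLit (.neg φ)
  | or {φ ψ : LTLX AP} : XOnlyLit φ → XOnlyLit ψ → XOnlyLit (.or φ ψ)
  | and {φ ψ : LTLX AP} : XOnlyLit φ → XOnlyLit ψ → XOnlyLit (.and φ ψ)
  | next {φ : LTLX AP} : NextChain φ → XOnlyLit (.next φ)

/-- Validity: `φ` is satisfied by every trace (for propositional formulas,
equivalently by every valuation). -/
def Valid (φ : LTLX AP) : Prop := ∀ σ : ℕ → Set AP, φ.sat σ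

open Classical in
/-- Replace an X-free formula `f` by `true` if `m → f` is valid, by `false`
if `m → ¬f` is valid, and leave it unchanged otherwise. -/
noncomputable def decideMode (m f : LTLX AP) : LTLX AP :=
  if Valid (m.imp f) then .tt
  else if Valid (m.imp (.neg f)) then .ff
  else f

open Classical in
/-- `RmModes(φ, m)`: replace every maximal X-free subformula `f` of `φ` with
`m → f` valid by `true`, and every maximal X-free subformula `f` with `m → ¬f`
valid by `false`. -/
noncomputable def rmModes (m : LTLX AP) : LTLX AP → LTLX AP
  | .neg ψ => if XFree (LTLX.neg ψ) then decideMode m (.neg ψ) else .neg (rmModes m ψ)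
  | .or ψ χ =>
      if XFree (LTLX.or ψ χ) then decideMode m (.or ψ χ)
      else .or (rmModes m ψ) (rmModes m χ)
  | .and ψ χ =>
      if XFree (LTLX.and ψ χ) then decideMode m (.and ψ χ)
      else .and (rmModes m ψ) (rmModes m χ)
  | .next ψ => .next ψ
  | φ => decideMode m φ

theorem sat_decideMode (m f : LTLX AP) (σ : ℕ → Set AP) (hσ : m.sat σ) :
    f.sat σ ↔ (decideMode m f).sat σ := by
  unfold decideMode
  split_ifs with h1 h2
  · have h := h1 σ
    simp only [LTLX.imp, LTLX.sat] at h ⊢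
    tauto
  · have h := h2 σ
    simp only [LTLX.imp, LTLX.sat] at h ⊢
    tauto
  · rfl

/-- for a propositional formula `m` and an LTL_X formula `φ` in
which `X` is applied only to literals, every trace `σ` whose first letter
satisfies `m` satisfies `φ` if and only if it satisfies `RmModes(φ, m)`. -/
theorem sat_rmModes (m φ : LTLX AP) (hm : XFree m) (hφ : XOnlyLit φ)
    (σ : ℕ → Set AP) (hσ : m.sat σ) :
    φ.sat σ ↔ (rmModes m φ).sat σ := by
  clear hφ hm
  induction φ with
  | tt => exact sat_decideMode m _ σ hσ
  | ff => exact sat_decideMode m _ σ hσ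
  | atom a => exact sat_decideMode m _ σ hσ
  | neg ψ ih =>
    rw [rmModes]
    split_ifs
    · exact sat_decideMode m _ σ hσ
    · simp only [LTLX.sat, ih]
  | or ψ χ ih1 ih2 =>
    rw [rmModes]
    split_ifs
    · exact sat_decideMode m _ σ hσ
    · simp only [LTLX.sat, ih1, ih2]
  | and ψ χ ih1 ih2 =>
    rw [rmModes]
    split_ifs
    · exact sat_decideMode m _ σ hσ
    · simp only [LTLX.sat, ih1, ih2]
  | next ψ ih => rw [rmModes]
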